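/- arXiv:1611.06258 — 2 statements merged into one kernel-verified Lean document; each statement's English description precedes it below -/
import Mathlib

section
/- Let H be a real rational function that is a minimum function with minimum frequency ω₀, and write H(jω₀) = jω₀X where X is real. If X < 0, then there exist real numbers ν > 0 and β > 0 and a positive-real rational function H̃_r whose McMillan degree is at most the McMillan degree of H minus 2, such that, as an identity of rational functions, H(s) = H(ν)·(H̃_r(s)s³ + νs² + H̃_r(s)(ω₀² + 2βν)s + νω₀²) / (s³ + H̃_r(s)(2β+ν)s² + ω₀²s + H̃_r(s)νω₀²). -/
open Polynomial Matrix

/-- Evaluation of a real rational function at a complex point: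
`p(λ)/q(λ)` for `H = p/q` in coprime (num/denom) form. -/
noncomputable def evalC (H : RatFunc ℝ) (z : ℂ) : ℂ :=
  H.num.eval₂ (algebraMap ℝ ℂ) z / H.denom.eval₂ (algebraMap ℝ ℂ) z

/-- Evaluation of a real rational function at a real point. -/
noncomputable def evalR (H : RatFunc ℝ) (x : ℝ) : ℝ :=
  H.num.eval x / H.denom.eval x

/-- `H` is positive-real: the denominator has no root with strictly positive real
part, and `Re (H λ) ≥ 0` whenever `Re λ > 0`. -/
def IsPR (H : RatFunc ℝ) : Prop :=
  (∀ z : ℂ, 0 < z.re → H.denom.eval₂ (algebraMap ℝ ℂ) z ≠ 0) ∧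
  (∀ z : ℂ, 0 < z.re → 0 ≤ (evalC H z).re)

/-- `H` has no poles or zeros on `jℝ ∪ ∞`: numerator and denominator have equal
degree and neither has a purely imaginary root. -/
def NoImagPolesZeros (H : RatFunc ℝ) : Prop :=
  H.num.natDegree = H.denom.natDegree ∧
  (∀ ω : ℝ, H.num.eval₂ (algebraMap ℝ ℂ) ((ω : ℂ) * Complex.I) ≠ 0) ∧
  (∀ ω : ℝ, H.denom.eval₂ (algebraMap ℝ ℂ) ((ω : ℂ) * Complex.I) ≠ 0)

/-- `H` is a minimum function with minimum frequency `ω₀`. -/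
def IsMinFun (H : RatFunc ℝ) (ω₀ : ℝ) : Prop :=
  IsPR H ∧ H ≠ 0 ∧ NoImagPolesZeros H ∧ 0 < ω₀ ∧
    (evalC H ((ω₀ : ℂ) * Complex.I)).re = 0

/-- The McMillan degree of a rational function. -/
noncomputable def McMillanDeg (H : RatFunc ℝ) : ℕ :=
  max H.num.natDegree H.denom.natDegree

/-- The biquadratic parametrisation of Lemma `bmfp`. -/
noncomputable def Hparam (K ω₀ W F : ℝ) : RatFunc ℝ :=
  RatFunc.C K *
    (RatFunc.X ^ 2 + RatFunc.C (ω₀ * (1 - W) * F / W) * RatFunc.X +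
        RatFunc.C (ω₀ ^ 2 * W)) /
    (RatFunc.X ^ 2 + RatFunc.C (ω₀ * (1 - W) / F) * RatFunc.X +
        RatFunc.C (ω₀ ^ 2 / W))

/-- Composition of a rational function with the map `s ↦ ω₀²/s`. -/
noncomputable def freqInv (ω₀ : ℝ) (H : RatFunc ℝ) : RatFunc ℝ :=
  RatFunc.eval (algebraMap ℝ (RatFunc ℝ)) (RatFunc.C (ω₀ ^ 2) / RatFunc.X) H

/-- The basic identity behind the half-plane version of the Schwarz–Pick inequality. -/
lemma sq_norm_add_conj (a b : ℂ) :
    ‖a + starRingEnd ℂ b‖ ^ 2 = ‖a - b‖ ^ 2 + 4 * (a.re * b.re) := by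
  simp only [Complex.sq_norm, Complex.normSq_apply, Complex.add_re, Complex.add_im,
    Complex.sub_re, Complex.sub_im, Complex.conj_re, Complex.conj_im]
  ring

lemma norm_sub_le_norm_add_conj {a b : ℂ} (ha : 0 ≤ a.re) (hb : 0 ≤ b.re) :
    ‖a - b‖ ≤ ‖a + starRingEnd ℂ b‖ := by
  have h := sq_norm_add_conj a b
  have h' := mul_nonneg ha hb
  exact (sq_le_sq₀ (norm_nonneg _) (norm_nonneg _)).1 (by linarith)

lemma add_conj_ne_zero {a b : ℂ} (ha : 0 ≤ a.re) (hb : 0 < b.re) :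
    a + starRingEnd ℂ b ≠ 0 := by
  intro h
  have := congrArg Complex.re h
  simp at this
  linarith

/-- The Schwarz–Pick inequality on the right half-plane, with base point mapped to the open
half-plane. -/
lemma schwarzPick_of_pos {f : ℂ → ℂ} (hf : DifferentiableOn ℂ f {z | 0 < z.re})
    (hre : ∀ z : ℂ, 0 < z.re → 0 ≤ (f z).re) {z w : ℂ} (hz : 0 < z.re) (hw : 0 < w.re)
    (hfw : 0 < (f w).re) :
    ‖f z - f w‖ * ‖z + starRingEnd ℂ w‖ ≤ ‖z - w‖ * ‖f z + starRingEnd ℂ (f w)‖ := by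
  set S : ℂ → ℂ := fun ζ => (w + starRingEnd ℂ w * ζ) / (1 - ζ) with hS
  have hne : ∀ ζ ∈ Metric.ball (0 : ℂ) 1, 1 - ζ ≠ 0 := by
    intro ζ hζ h
    rw [mem_ball_zero_iff, ← sub_eq_zero.1 h] at hζ
    simp at hζ
  have hSre : ∀ ζ ∈ Metric.ball (0 : ℂ) 1, 0 < (S ζ).re := by
    intro ζ hζ
    have h1 : 0 < Complex.normSq (1 - ζ) := Complex.normSq_pos.2 (hne ζ hζ)
    have h2 : ‖ζ‖ ^ 2 < 1 := by
      rw [mem_ball_zero_iff] at hζ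
      nlinarith [norm_nonneg ζ]
    have h3 : (S ζ).re = w.re * (1 - ‖ζ‖ ^ 2) / Complex.normSq (1 - ζ) := by
      simp only [hS, Complex.div_re, Complex.sq_norm]
      rw [← add_div]
      congr 1
      simp [Complex.normSq_apply]
      ring
    rw [h3]
    have : 0 < 1 - ‖ζ‖ ^ 2 := by linarith
    positivity
  have hSd : DifferentiableOn ℂ S (Metric.ball 0 1) := by
    intro ζ hζ
    have := hne ζ hζ
    exact DifferentiableAt.differentiableWithinAt (by fun_prop (disch := assumption))
  set g : ℂ → ℂ := fun ζ => (f (S ζ) - f w) / (f (S ζ) + starRingEnd ℂ (f w)) with hg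
  have hfS : DifferentiableOn ℂ (fun ζ => f (S ζ)) (Metric.ball 0 1) :=
    hf.comp hSd hSre
  have hgd : DifferentiableOn ℂ g (Metric.ball 0 1) :=
    (hfS.sub_const _).div (hfS.add_const _)
      fun ζ hζ => add_conj_ne_zero (hre _ (hSre ζ hζ)) hfw
  have hgm : Set.MapsTo g (Metric.ball 0 1) (Metric.closedBall 0 1) := by
    intro ζ hζ
    rw [mem_closedBall_zero_iff, norm_div]
    exact div_le_one_of_le₀ (norm_sub_le_norm_add_conj (hre _ (hSre ζ hζ)) hfw.le)
      (norm_nonneg _)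
  have hg0 : g 0 = 0 := by simp [hg, hS]
  have hzw := add_conj_ne_zero hz.le hw
  have hzw' : 0 < ‖z + starRingEnd ℂ w‖ := norm_pos_iff.2 hzw
  have hfzw : 0 < ‖f z + starRingEnd ℂ (f w)‖ :=
    norm_pos_iff.2 (add_conj_ne_zero (hre z hz) hfw)
  have hww : w + starRingEnd ℂ w ≠ 0 := add_conj_ne_zero hw.le hw
  have hζ : ‖(z - w) / (z + starRingEnd ℂ w)‖ < 1 := by
    rw [norm_div, div_lt_one hzw']
    have h := sq_norm_add_conj z w
    have h' := mul_pos hz hw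
    exact (sq_lt_sq₀ (norm_nonneg _) (norm_nonneg _)).1 (by linarith)
  have hSz : S ((z - w) / (z + starRingEnd ℂ w)) = z := by
    have h1 : 1 - (z - w) / (z + starRingEnd ℂ w)
        = (w + starRingEnd ℂ w) / (z + starRingEnd ℂ w) := by
      field_simp; ring
    simp only [hS]
    rw [h1]
    field_simp
    ring
  have key := Complex.norm_le_norm_of_mapsTo_ball hgd hgm hg0 hζ
  simp only [hg] at key
  rw [hSz, norm_div, norm_div, div_le_div_iff₀ hfzw hzw'] at key
  exact key

/-- The Schwarz–Pick inequality for holomorphic functions with nonnegative real part on the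
right half-plane. -/
lemma schwarzPick {f : ℂ → ℂ} (hf : DifferentiableOn ℂ f {z | 0 < z.re})
    (hre : ∀ z : ℂ, 0 < z.re → 0 ≤ (f z).re) {z w : ℂ} (hz : 0 < z.re) (hw : 0 < w.re) :
    ‖f z - f w‖ * ‖z + starRingEnd ℂ w‖ ≤ ‖z - w‖ * ‖f z + starRingEnd ℂ (f w)‖ := by
  have hlim : Filter.Tendsto
      (fun ε : ℝ => ‖z - w‖ * ‖(f z + (ε : ℂ)) + starRingEnd ℂ (f w + (ε : ℂ))‖)
      (nhdsWithin 0 (Set.Ioi 0)) (nhds (‖z - w‖ * ‖f z + starRingEnd ℂ (f w)‖)) := by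
    have hc : Continuous
        (fun ε : ℝ => ‖z - w‖ * ‖(f z + (ε : ℂ)) + starRingEnd ℂ (f w + (ε : ℂ))‖) := by
      fun_prop
    simpa using (hc.tendsto 0).mono_left nhdsWithin_le_nhds
  refine ge_of_tendsto hlim ?_
  filter_upwards [self_mem_nhdsWithin] with ε hε
  have hε' : (0 : ℝ) < ε := hε
  have := schwarzPick_of_pos (f := fun s => f s + (ε : ℂ)) (hf.add_const _)
    (fun s hs => by simpa using add_nonneg (hre s hs) hε'.le) hz hw
    (by simpa using add_pos_of_nonneg_of_pos (hre w hw) hε')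
  simpa using this

/-- The two-point Pick inequality on the right half-plane. -/
lemma pick_inequality {f : ℂ → ℂ} (hf : DifferentiableOn ℂ f {z | 0 < z.re})
    (hre : ∀ z : ℂ, 0 < z.re → 0 ≤ (f z).re) {z w : ℂ} (hz : 0 < z.re) (hw : 0 < w.re) :
    ‖f z + starRingEnd ℂ (f w)‖ ^ 2 * (z.re * w.re)
      ≤ ‖z + starRingEnd ℂ w‖ ^ 2 * ((f z).re * (f w).re) := by
  have h := schwarzPick hf hre hz hw
  have h2 : (‖f z - f w‖ * ‖z + starRingEnd ℂ w‖) ^ 2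
      ≤ (‖z - w‖ * ‖f z + starRingEnd ℂ (f w)‖) ^ 2 :=
    pow_le_pow_left₀ (by positivity) h 2
  rw [mul_pow, mul_pow] at h2
  have e1 := sq_norm_add_conj z w
  have e2 := sq_norm_add_conj (f z) (f w)
  rw [eq_sub_of_add_eq e1.symm, eq_sub_of_add_eq e2.symm] at h2
  nlinarith [h2]

/-- A Julia-type boundary inequality at the point `aj` of the imaginary axis. -/
lemma julia_inequality {f : ℂ → ℂ} (hf : DifferentiableOn ℂ f {z | 0 < z.re})
    (hre : ∀ z : ℂ, 0 < z.re → 0 ≤ (f z).re) {a : ℝ} {u : ℂ}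
    (hu : Filter.Tendsto (fun ε : ℝ => ((ε : ℂ) * f (a * Complex.I + ε))⁻¹)
      (nhdsWithin 0 (Set.Ioi 0)) (nhds u))
    (hne : ∀ᶠ ε : ℝ in nhdsWithin 0 (Set.Ioi 0), f (a * Complex.I + ε) ≠ 0)
    {z : ℂ} (hz : 0 < z.re) :
    z.re ≤ ‖z - a * Complex.I‖ ^ 2 * ((f z).re * u.re) := by
  have hε0 : Filter.Tendsto (fun ε : ℝ => (ε : ℂ)) (nhdsWithin 0 (Set.Ioi 0)) (nhds 0) := by
    simpa using (Complex.continuous_ofReal.tendsto 0).mono_left nhdsWithin_le_nhds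
  have hl : Filter.Tendsto
      (fun ε : ℝ => ‖1 + f z * ((ε : ℂ) * starRingEnd ℂ ((ε : ℂ) * f (a * Complex.I + ε))⁻¹)‖ ^ 2
        * z.re) (nhdsWithin 0 (Set.Ioi 0)) (nhds (‖1 + f z * (0 * starRingEnd ℂ u)‖ ^ 2 * z.re)) :=
    (((hε0.mul ((Complex.continuous_conj.tendsto u).comp hu)).const_mul
      (f z)).const_add 1 |>.norm.pow 2).mul_const _
  have hr : Filter.Tendsto
      (fun ε : ℝ => ‖z - a * Complex.I + ε‖ ^ 2 *
        ((f z).re * ((ε : ℂ) * f (a * Complex.I + ε))⁻¹.re)) (nhdsWithin 0 (Set.Ioi 0))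
      (nhds (‖z - a * Complex.I + 0‖ ^ 2 * ((f z).re * u.re))) :=
    ((hε0.const_add _).norm.pow 2).mul
      (((Complex.continuous_re.tendsto u).comp hu).const_mul _)
  have hle := le_of_tendsto_of_tendsto hl hr (by
    filter_upwards [hne, self_mem_nhdsWithin] with ε hfε hε
    have hε' : (0 : ℝ) < ε := hε
    have hεc : (ε : ℂ) ≠ 0 := by exact_mod_cast hε'.ne'
    have hp := pick_inequality hf hre hz (w := a * Complex.I + ε) (by simpa using hε')
    set y := f (a * Complex.I + ε) with hy
    have hy2 : 0 < ‖y‖ ^ 2 := by positivity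
    have hcy : starRingEnd ℂ y ≠ 0 := by simpa using hfε
    have e1 : ‖1 + f z * ((ε : ℂ) * starRingEnd ℂ ((ε : ℂ) * y)⁻¹)‖ ^ 2
        = ‖f z + starRingEnd ℂ y‖ ^ 2 / ‖y‖ ^ 2 := by
      have : 1 + f z * ((ε : ℂ) * starRingEnd ℂ ((ε : ℂ) * y)⁻¹)
          = (f z + starRingEnd ℂ y) / starRingEnd ℂ y := by
        simp only [map_inv₀, map_mul, Complex.conj_ofReal]
        field_simp
        ring
      rw [this, norm_div, div_pow, Complex.norm_conj]
    have e2 : (((ε : ℂ) * y)⁻¹).re = y.re / (ε * ‖y‖ ^ 2) := by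
      rw [Complex.inv_re, map_mul, Complex.normSq_ofReal, Complex.sq_norm,
        Complex.re_ofReal_mul]
      field_simp
    have e3 : z + starRingEnd ℂ (a * Complex.I + ε) = z - a * Complex.I + ε := by
      simp; ring
    rw [e3] at hp
    simp only [Complex.add_re, Complex.mul_re, Complex.ofReal_re, Complex.I_re,
      Complex.ofReal_im, Complex.I_im, mul_zero, zero_mul, sub_zero, zero_add] at hp
    rw [e1, e2, div_mul_eq_mul_div, ← mul_div_assoc, ← mul_div_assoc,
      div_le_div_iff₀ hy2 (by positivity)]
    nlinarith [mul_le_mul_of_nonneg_right hp hy2.le])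
  simpa using hle

lemma evalC_eq_aeval (H : RatFunc ℝ) (z : ℂ) :
    evalC H z = aeval z H.num / aeval z H.denom := rfl

lemma evalC_algebraMap_div (A : ℝ[X]) {B : ℝ[X]} {z : ℂ} (hB : aeval z B ≠ 0) :
    evalC (algebraMap ℝ[X] (RatFunc ℝ) A / algebraMap ℝ[X] (RatFunc ℝ) B) z
      = aeval z A / aeval z B := by
  have hB0 : B ≠ 0 := by rintro rfl; simp at hB
  have h := (RatFunc.num_mul_eq_mul_denom_iff (p := A) hB0).2 rfl
  have h' := congrArg (aeval z) h
  rw [map_mul, map_mul] at h'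
  obtain ⟨c, hc⟩ := RatFunc.denom_div_dvd A B
  have hd : aeval z (RatFunc.denom (algebraMap ℝ[X] (RatFunc ℝ) A / algebraMap _ _ B)) ≠ 0 := by
    intro h0
    apply hB
    rw [hc, map_mul, h0, zero_mul]
  rw [evalC_eq_aeval, div_eq_div_iff hd hB, h']

lemma eventually_aeval_ne_zero {B : ℝ[X]} (hB : B ≠ 0) (z : ℂ) :
    ∀ᶠ w in nhdsWithin z {z}ᶜ, aeval w B ≠ 0 := by
  have hB' : B.map (algebraMap ℝ ℂ) ≠ 0 :=
    (Polynomial.map_ne_zero_iff (algebraMap ℝ ℂ).injective).2 hB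
  have hfin : {w : ℂ | (B.map (algebraMap ℝ ℂ)).IsRoot w}.Finite :=
    Polynomial.finite_setOfPred_isRoot hB'
  have := hfin.isClosed.isOpen_compl
  have h2 : (({w : ℂ | (B.map (algebraMap ℝ ℂ)).IsRoot w} \ {z})ᶜ : Set ℂ) ∈ nhds z :=
    (hfin.subset Set.sdiff_subset).isClosed.isOpen_compl.mem_nhds (by simp)
  filter_upwards [nhdsWithin_le_nhds h2, self_mem_nhdsWithin] with w hw hwz h0
  refine hw ⟨?_, hwz⟩
  rwa [Set.mem_ofPred_eq, Polynomial.IsRoot, Polynomial.eval_map_algebraMap]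

lemma continuous_aeval_complex (B : ℝ[X]) : Continuous fun z : ℂ => aeval z B :=
  B.continuous_aeval

lemma differentiable_aeval_complex (B : ℝ[X]) : Differentiable ℂ fun z : ℂ => aeval z B :=
  B.differentiable_aeval

lemma isOpen_rightHalfPlane : IsOpen {z : ℂ | 0 < z.re} :=
  isOpen_lt continuous_const Complex.continuous_re

/-- A holomorphic function near `z₀` with nonnegative real part and vanishing at `z₀` vanishes
near `z₀`. -/
lemma eventually_eq_zero_of_re_nonneg {g : ℂ → ℂ} {z₀ : ℂ} (hg : AnalyticAt ℂ g z₀)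
    (hre : ∀ᶠ z in nhds z₀, 0 ≤ (g z).re) (h0 : g z₀ = 0) : ∀ᶠ z in nhds z₀, g z = 0 := by
  rcases hg.eventually_constant_or_nhds_le_map_nhds with h | h
  · simpa [h0] using h
  · exfalso
    rw [h0] at h
    have h1 : ∀ᶠ w in nhds (0 : ℂ), 0 ≤ w.re := h hre
    have h2 : Filter.Tendsto (fun ε : ℝ => (-(ε : ℂ))) (nhdsWithin 0 (Set.Ioi 0)) (nhds 0) := by
      have hc : Continuous fun ε : ℝ => (-(ε : ℂ)) := by fun_prop
      simpa using (hc.tendsto 0).mono_left nhdsWithin_le_nhds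
    obtain ⟨ε, hε, hε'⟩ := ((h2.eventually h1).and self_mem_nhdsWithin).exists
    have : (0 : ℝ) < ε := hε'
    simp at hε
    linarith

lemma div_re_eq (a b : ℂ) : (a / b).re = (a * starRingEnd ℂ b).re / ‖b‖ ^ 2 := by
  rw [Complex.div_re, Complex.sq_norm]
  simp
  ring

/-- A quotient of real polynomials is positive-real as soon as its real part is nonnegative at
the points of the open right half-plane where the denominator does not vanish. -/
lemma isPR_algebraMap_div {A B : ℝ[X]} (hB : B ≠ 0)
    (h : ∀ z : ℂ, 0 < z.re → aeval z B ≠ 0 → 0 ≤ (aeval z A / aeval z B).re) :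
    IsPR (algebraMap ℝ[X] (RatFunc ℝ) A / algebraMap ℝ[X] (RatFunc ℝ) B) := by
  set R := algebraMap ℝ[X] (RatFunc ℝ) A / algebraMap ℝ[X] (RatFunc ℝ) B with hR
  have hd0 := R.denom_ne_zero
  have key : ∀ z : ℂ, 0 < z.re →
      0 ≤ (aeval z R.num * starRingEnd ℂ (aeval z R.denom)).re := by
    intro z hz
    have hc : Continuous fun w : ℂ =>
        (aeval w R.num * starRingEnd ℂ (aeval w R.denom)).re :=
      Complex.continuous_re.comp ((continuous_aeval_complex _).mul
        (Complex.continuous_conj.comp (continuous_aeval_complex _)))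
    refine ge_of_tendsto ((hc.tendsto z).mono_left (nhdsWithin_le_nhds (s := {z}ᶜ))) ?_
    filter_upwards [eventually_aeval_ne_zero hB z, eventually_aeval_ne_zero hd0 z,
      nhdsWithin_le_nhds (isOpen_rightHalfPlane.mem_nhds hz)] with w hw hdw hwre
    have h1 := h w hwre hw
    rw [← evalC_algebraMap_div A hw, ← hR, evalC_eq_aeval, div_re_eq] at h1
    have : 0 < ‖aeval w R.denom‖ ^ 2 := by positivity
    have h2 := mul_nonneg h1 this.le
    rwa [div_mul_cancel₀ _ this.ne'] at h2
  refine ⟨fun z hz hdz => ?_, fun z hz => ?_⟩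
  · have hdz' : aeval z R.denom = 0 := hdz
    have hnz : aeval z R.num ≠ 0 := by
      intro hnz
      obtain ⟨a, b, hab⟩ := R.isCoprime_num_denom
      have := congrArg (aeval z) hab
      simp [hdz', hnz] at this
    have hev : ∀ᶠ w in nhds z, aeval w R.num ≠ 0 :=
      (continuous_aeval_complex R.num).continuousAt.eventually_ne hnz
    have han : AnalyticAt ℂ (fun w : ℂ => aeval w R.denom / aeval w R.num) z :=
      ((differentiable_aeval_complex _).analyticAt z).div
        ((differentiable_aeval_complex _).analyticAt z) hnz
    have h0 := eventually_eq_zero_of_re_nonneg han (by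
      filter_upwards [isOpen_rightHalfPlane.mem_nhds hz] with w hw
      rw [div_re_eq]
      refine div_nonneg ?_ (by positivity)
      have h1 := key w hw
      rw [← Complex.conj_re] at h1
      simpa [mul_comm] using h1) (by simp [hdz'])
    obtain ⟨w, ⟨hw1, hw2⟩, hw3⟩ := (((h0.and hev).filter_mono
      (nhdsWithin_le_nhds (s := {z}ᶜ))).and (eventually_aeval_ne_zero hd0 z)).exists
    simp [hw2, hw3] at hw1
  · rw [evalC_eq_aeval, div_re_eq]
    exact div_nonneg (key z hz) (by positivity)

lemma differentiableOn_evalC {R : RatFunc ℝ} (hR : IsPR R) :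
    DifferentiableOn ℂ (evalC R) {z | 0 < z.re} :=
  (differentiable_aeval_complex R.num).differentiableOn.div
    (differentiable_aeval_complex R.denom).differentiableOn fun z hz => hR.1 z hz

lemma mcMillanDeg_algebraMap_div_le {A B : ℝ[X]} (hA : A ≠ 0) (hB : B ≠ 0) :
    McMillanDeg (algebraMap ℝ[X] (RatFunc ℝ) A / algebraMap ℝ[X] (RatFunc ℝ) B)
      ≤ max A.natDegree B.natDegree :=
  max_le_max (natDegree_le_of_dvd (RatFunc.num_div_dvd A hB) hA)
    (natDegree_le_of_dvd (RatFunc.denom_div_dvd A B) hB)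

lemma evalC_ofReal (H : RatFunc ℝ) (x : ℝ) : evalC H (x : ℂ) = (evalR H x : ℂ) := by
  simp only [evalC, evalR]
  rw [← aeval_def, ← aeval_def, Complex.ofReal_div]
  congr 1 <;> exact aeval_algebraMap_apply ℂ x _

/-- If `H` is positive-real without poles or zeros on the extended imaginary axis, then
`x H(x) = c` has a positive solution for every `c > 0`. -/
lemma exists_pos_mul_evalR_eq {H : RatFunc ℝ} (hPR : IsPR H) (h0 : H ≠ 0)
    (hN : NoImagPolesZeros H) {c : ℝ} (hc : 0 < c) :
    ∃ ν : ℝ, 0 < ν ∧ H.denom.eval ν ≠ 0 ∧ ν * evalR H ν = c := by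
  have hden : ∀ x : ℝ, 0 ≤ x → H.denom.eval x ≠ 0 := by
    intro x hx h
    have hz : aeval (x : ℂ) H.denom = 0 := by
      have := aeval_algebraMap_apply ℂ x H.denom
      rw [coe_aeval_eq_eval] at this
      simpa [h] using this
    rcases hx.eq_or_lt with rfl | hx
    · refine hN.2.2 0 ?_
      rw [← aeval_def]
      simpa using hz
    · exact hPR.1 x (by simpa using hx) hz
  have hnn : ∀ x : ℝ, 0 < x → 0 ≤ evalR H x := by
    intro x hx
    have := hPR.2 x (by simpa using hx)
    rwa [evalC_ofReal, Complex.ofReal_re] at this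
  have hnum : H.num ≠ 0 := RatFunc.num_ne_zero h0
  have hdeg : H.num.degree = H.denom.degree := by
    rw [degree_eq_natDegree hnum, degree_eq_natDegree H.denom_ne_zero, hN.1]
  have hlim : Filter.Tendsto (evalR H) Filter.atTop
      (nhds (H.num.leadingCoeff / H.denom.leadingCoeff)) :=
    div_tendsto_atTop_leadingCoeff_div_of_degree_eq _ _ hdeg
  have hl0 : H.num.leadingCoeff / H.denom.leadingCoeff ≠ 0 :=
    div_ne_zero (leadingCoeff_ne_zero.2 hnum) (leadingCoeff_ne_zero.2 H.denom_ne_zero)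
  have hl : 0 < H.num.leadingCoeff / H.denom.leadingCoeff :=
    lt_of_le_of_ne (ge_of_tendsto hlim (by
      filter_upwards [Filter.eventually_gt_atTop 0] with x hx using hnn x hx)) hl0.symm
  have htop : Filter.Tendsto (fun x => x * evalR H x) Filter.atTop Filter.atTop :=
    Filter.tendsto_id.atTop_mul_pos hl hlim
  obtain ⟨M, hM, hMc⟩ := ((Filter.eventually_ge_atTop (0 : ℝ)).and
    (htop.eventually_ge_atTop c)).exists
  have hcont : ContinuousOn (fun x => x * evalR H x) (Set.Icc 0 M) :=
    continuousOn_id.mul (H.num.continuousOn.div H.denom.continuousOn fun x hx => hden x hx.1)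
  obtain ⟨ν, hν, hνc⟩ := intermediate_value_Icc hM hcont
    (show c ∈ Set.Icc _ _ from ⟨by simpa using hc.le, hMc⟩)
  have hν0 : 0 < ν := by
    refine lt_of_le_of_ne hν.1 ?_
    rintro rfl
    simp at hνc
    exact hc.ne hνc
  exact ⟨ν, hν0, hden ν hν0.le, hνc⟩

lemma aeval_conj_complex (A : ℝ[X]) (z : ℂ) :
    aeval (starRingEnd ℂ z) A = starRingEnd ℂ (aeval z A) :=
  aeval_conj A z

lemma evalC_conj (R : RatFunc ℝ) (z : ℂ) :
    evalC R (starRingEnd ℂ z) = starRingEnd ℂ (evalC R z) := by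
  rw [evalC_eq_aeval, evalC_eq_aeval, aeval_conj_complex, aeval_conj_complex, map_div₀]

/-- Removing a simple pole with positive residue on the imaginary axis keeps the real part
nonnegative on the right half-plane. -/
lemma re_sub_simple_pole_nonneg {f : ℂ → ℂ} (hf : DifferentiableOn ℂ f {z | 0 < z.re})
    (hre : ∀ z : ℂ, 0 < z.re → 0 ≤ (f z).re) {a β : ℝ} (hβ : 0 < β)
    (hlim : Filter.Tendsto (fun ε : ℝ => (ε : ℂ) * f (a * Complex.I + ε))
      (nhdsWithin 0 (Set.Ioi 0)) (nhds (β : ℂ))) {z : ℂ} (hz : 0 < z.re) :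
    0 ≤ (f z - β / (z - a * Complex.I)).re := by
  have hβc : (β : ℂ) ≠ 0 := by exact_mod_cast hβ.ne'
  have hJ := julia_inequality hf hre (hlim.inv₀ hβc)
    ((hlim.eventually_ne hβc).mono fun ε h => right_ne_zero_of_mul h) hz
  have hza : z - a * Complex.I ≠ 0 := by
    intro h
    have := congrArg Complex.re h
    simp at this
    exact hz.ne' this
  have hpos : 0 < ‖z - a * Complex.I‖ ^ 2 := by positivity
  have e : ((β : ℂ) / (z - a * Complex.I)).re = β * z.re / ‖z - a * Complex.I‖ ^ 2 := by
    rw [div_re_eq, Complex.re_ofReal_mul]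
    simp
  rw [Complex.sub_re, e, sub_nonneg, div_le_iff₀ hpos]
  rw [← Complex.ofReal_inv, Complex.ofReal_re] at hJ
  calc β * z.re ≤ β * (‖z - a * Complex.I‖ ^ 2 * ((f z).re * β⁻¹)) := by gcongr
    _ = (f z).re * ‖z - a * Complex.I‖ ^ 2 := by field_simp

/-- Boundary approach to a point of the imaginary axis along the real direction. -/
lemma tendsto_add_ofReal (p : ℂ) :
    Filter.Tendsto (fun ε : ℝ => p + (ε : ℂ)) (nhdsWithin 0 (Set.Ioi 0)) (nhds p) := by
  have hc : Continuous fun ε : ℝ => p + (ε : ℂ) := by fun_prop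
  simpa using (hc.tendsto 0).mono_left nhdsWithin_le_nhds

lemma sq_add_sq_ne_zero {z : ℂ} (hz : 0 < z.re) (ω : ℝ) : z ^ 2 + (ω : ℂ) ^ 2 ≠ 0 := by
  have e : z ^ 2 + (ω : ℂ) ^ 2 = (z - ω * Complex.I) * (z - (-ω : ℝ) * Complex.I) := by
    push_cast
    linear_combination ((ω : ℂ) ^ 2) * Complex.I_sq
  rw [e]
  refine mul_ne_zero ?_ ?_ <;>
  · intro h
    have := congrArg Complex.re h
    simp at this
    exact hz.ne' this

/-- A pole of a positive-real function on the imaginary axis is simple with positive residue. -/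
lemma exists_residue_pos {R : RatFunc ℝ} (hR : IsPR R) {A D : ℝ[X]} {ω : ℝ} (hω : 0 < ω)
    (hD : D ≠ 0) (hA : aeval ((ω : ℂ) * Complex.I) A ≠ 0)
    (hRA : ∀ z : ℂ, 0 < z.re → aeval z D ≠ 0 →
      evalC R z = aeval z A / ((z ^ 2 + (ω : ℂ) ^ 2) * aeval z D)) :
    ∃ β : ℝ, 0 < β ∧
      aeval ((ω : ℂ) * Complex.I) A
        = 2 * β * ((ω : ℂ) * Complex.I) * aeval ((ω : ℂ) * Complex.I) D ∧
      Filter.Tendsto (fun ε : ℝ => (ε : ℂ) * evalC R (ω * Complex.I + ε))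
        (nhdsWithin 0 (Set.Ioi 0)) (nhds (β : ℂ)) := by
  set p : ℂ := (ω : ℂ) * Complex.I with hp
  have hp2 : p ^ 2 = -(ω : ℂ) ^ 2 := by rw [hp, mul_pow, Complex.I_sq]; ring
  set u : ℂ := 2 * p * aeval p D / aeval p A with hu
  have hto := tendsto_add_ofReal p
  have hne : ∀ᶠ ε : ℝ in nhdsWithin 0 (Set.Ioi 0),
      aeval (p + (ε : ℂ)) A ≠ 0 ∧ aeval (p + (ε : ℂ)) D ≠ 0 ∧ 0 < ε := by
    have h1 : Filter.Tendsto (fun ε : ℝ => p + (ε : ℂ)) (nhdsWithin 0 (Set.Ioi 0))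
        (nhdsWithin p {p}ᶜ) := by
      refine tendsto_nhdsWithin_iff.2 ⟨hto, ?_⟩
      filter_upwards [self_mem_nhdsWithin] with ε hε
      have : (0 : ℝ) < ε := hε
      simpa using this.ne'
    filter_upwards [hto.eventually ((continuous_aeval_complex A).continuousAt.eventually_ne hA),
      h1.eventually (eventually_aeval_ne_zero hD p), self_mem_nhdsWithin] with ε h1 h2 h3
    exact ⟨h1, h2, h3⟩
  have hval : ∀ ε : ℝ, aeval (p + (ε : ℂ)) D ≠ 0 → 0 < ε →
      evalC R (p + ε) = aeval (p + (ε : ℂ)) A / ((ε * (2 * p + ε)) * aeval (p + (ε : ℂ)) D) := by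
    intro ε h hε
    rw [hRA _ (by simpa [hp] using hε) h]
    congr 2
    linear_combination hp2
  have hpε : ∀ ε : ℝ, 0 < ε → 2 * p + ε ≠ 0 := by
    intro ε hε h
    have := congrArg Complex.re h
    simp [hp] at this
    exact hε.ne' this
  have hlim : Filter.Tendsto (fun ε : ℝ => ((ε : ℂ) * evalC R (p + ε))⁻¹)
      (nhdsWithin 0 (Set.Ioi 0)) (nhds u) := by
    have h1 : ContinuousAt (fun z : ℂ => (p + z) * aeval z D / aeval z A) p :=
      ((continuousAt_const.add continuousAt_id).mul
        (continuous_aeval_complex D).continuousAt).div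
        (continuous_aeval_complex A).continuousAt hA
    have h2 := h1.tendsto.comp hto
    have h3 : (p + p) * aeval p D / aeval p A = u := by rw [hu, two_mul]
    rw [h3] at h2
    refine h2.congr' ?_
    filter_upwards [hne] with ε ⟨hAε, hDε, hε⟩
    have hεc : (ε : ℂ) ≠ 0 := by exact_mod_cast hε.ne'
    have := hpε ε hε
    rw [hval ε hDε hε]
    simp only [Function.comp]
    field_simp
    ring
  have hfne : ∀ᶠ ε : ℝ in nhdsWithin 0 (Set.Ioi 0), evalC R (p + ε) ≠ 0 := by
    filter_upwards [hne] with ε ⟨hAε, hDε, hε⟩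
    have hεc : (ε : ℂ) ≠ 0 := by exact_mod_cast hε.ne'
    rw [hval ε hDε hε]
    exact div_ne_zero hAε (mul_ne_zero (mul_ne_zero hεc (hpε ε hε)) hDε)
  have hure : 0 < u.re := by
    have h1 : (0 : ℝ) < (1 : ℂ).re := by simp
    have hJ := julia_inequality (differentiableOn_evalC hR) hR.2 hlim hfne h1
    have h2 := hR.2 1 h1
    rw [Complex.one_re] at hJ
    by_contra hcon
    have h3 : (evalC R 1).re * u.re ≤ 0 := mul_nonpos_of_nonneg_of_nonpos h2 (not_lt.1 hcon)
    have h4 : ‖1 - p‖ ^ 2 * ((evalC R 1).re * u.re) ≤ 0 :=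
      mul_nonpos_of_nonneg_of_nonpos (by positivity) h3
    linarith
  have hbd : ∀ y : ℝ, 0 ≤ (ω ^ 2 - y ^ 2) *
      (aeval ((y : ℂ) * Complex.I) A * starRingEnd ℂ (aeval ((y : ℂ) * Complex.I) D)).re := by
    intro y
    have hc : Continuous fun z : ℂ =>
        (aeval z A * starRingEnd ℂ ((z ^ 2 + (ω : ℂ) ^ 2) * aeval z D)).re :=
      Complex.continuous_re.comp ((continuous_aeval_complex _).mul
        (Complex.continuous_conj.comp
          ((by fun_prop : Continuous fun z : ℂ => z ^ 2 + (ω : ℂ) ^ 2).mul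
            (continuous_aeval_complex _))))
    have h1 := ge_of_tendsto (b := 0) ((hc.tendsto ((y : ℂ) * Complex.I)).comp
      (tendsto_add_ofReal ((y : ℂ) * Complex.I))) (by
        filter_upwards [self_mem_nhdsWithin] with ε hε
        have hε' : 0 < ((y : ℂ) * Complex.I + ε).re := by simpa using hε
        simp only [Function.comp]
        by_cases hDz : aeval ((y : ℂ) * Complex.I + ε) D = 0
        · simp [hDz]
        · have h2 := hR.2 _ hε'
          rw [hRA _ hε' hDz, div_re_eq] at h2
          have h3 := mul_ne_zero (sq_add_sq_ne_zero hε' ω) hDz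
          have h4 : 0 < ‖(((y : ℂ) * Complex.I + ε) ^ 2 + (ω : ℂ) ^ 2) *
            aeval ((y : ℂ) * Complex.I + ε) D‖ ^ 2 := by positivity
          have h5 := mul_nonneg h2 h4.le
          rwa [div_mul_cancel₀ _ h4.ne'] at h5)
    have e : ((y : ℂ) * Complex.I) ^ 2 + (ω : ℂ) ^ 2 = ((ω ^ 2 - y ^ 2 : ℝ) : ℂ) := by
      push_cast
      rw [mul_pow, Complex.I_sq]
      ring
    rw [e, map_mul, Complex.conj_ofReal, mul_left_comm, Complex.re_ofReal_mul] at h1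
    exact h1
  have hφ : (aeval p A * starRingEnd ℂ (aeval p D)).re = 0 := by
    have hc : Continuous fun y : ℝ =>
        (aeval ((y : ℂ) * Complex.I) A * starRingEnd ℂ (aeval ((y : ℂ) * Complex.I) D)).re :=
      Complex.continuous_re.comp (((continuous_aeval_complex A).comp (by fun_prop)).mul
        (Complex.continuous_conj.comp ((continuous_aeval_complex D).comp (by fun_prop))))
    apply le_antisymm
    · refine le_of_tendsto ((hc.tendsto ω).mono_left (nhdsWithin_le_nhds (s := Set.Ioi ω))) ?_
      filter_upwards [self_mem_nhdsWithin] with y hy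
      have hy' : ω < y := hy
      by_contra hcon
      have h1 := mul_neg_of_neg_of_pos (show ω ^ 2 - y ^ 2 < 0 by nlinarith) (not_le.1 hcon)
      exact absurd (hbd y) (not_le.2 h1)
    · refine ge_of_tendsto ((hc.tendsto ω).mono_left (nhdsWithin_le_nhds (s := Set.Iio ω))) ?_
      filter_upwards [self_mem_nhdsWithin, nhdsWithin_le_nhds (lt_mem_nhds hω)] with y hy hy0
      have hy' : y < ω := hy
      by_contra hcon
      have h1 := mul_neg_of_pos_of_neg (show 0 < ω ^ 2 - y ^ 2 by nlinarith) (not_le.1 hcon)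
      exact absurd (hbd y) (not_le.2 h1)
  have huim : u.im = 0 := by
    have e : u = ((2 * ω / ‖aeval p A‖ ^ 2 : ℝ) : ℂ) *
        (Complex.I * (aeval p D * starRingEnd ℂ (aeval p A))) := by
      have hn : ((‖aeval p A‖ ^ 2 : ℝ) : ℂ) = aeval p A * starRingEnd ℂ (aeval p A) := by
        rw [Complex.mul_conj, Complex.sq_norm]
      rw [Complex.ofReal_div, hn, hu]
      have hA' : starRingEnd ℂ (aeval p A) ≠ 0 := by simpa using hA
      push_cast
      field_simp
      rw [hp]
      ring
    rw [e, Complex.im_ofReal_mul, Complex.I_mul_im]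
    have : (aeval p D * starRingEnd ℂ (aeval p A)).re = 0 := by
      rw [← Complex.conj_re]
      simpa [mul_comm] using hφ
    rw [this, mul_zero]
  have hueq : u = (u.re : ℂ) := Complex.ext (by simp) (by simp [huim])
  have hu0 : u ≠ 0 := fun h => by simp [h] at hure
  refine ⟨u.re⁻¹, inv_pos.2 hure, ?_, ?_⟩
  · rw [Complex.ofReal_inv, ← hueq]
    have h1 : u * aeval p A = 2 * p * aeval p D := by
      rw [hu, div_mul_cancel₀ _ hA]
    field_simp
    linear_combination h1
  · rw [Complex.ofReal_inv, ← hueq]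
    simpa using hlim.inv₀ hu0

/-- Removing a conjugate pair of imaginary poles keeps the real part nonnegative. -/
lemma re_sub_pole_pair_nonneg {R : RatFunc ℝ} (hR : IsPR R) {ω β : ℝ} (hω : 0 < ω) (hβ : 0 < β)
    (hlim : Filter.Tendsto (fun ε : ℝ => (ε : ℂ) * evalC R (ω * Complex.I + ε))
      (nhdsWithin 0 (Set.Ioi 0)) (nhds (β : ℂ))) {z : ℂ} (hz : 0 < z.re) :
    0 ≤ (evalC R z - 2 * β * z / (z ^ 2 + (ω : ℂ) ^ 2)).re := by
  have hne : ∀ z : ℂ, 0 < z.re → ∀ a : ℝ, z - a * Complex.I ≠ 0 := by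
    intro z hz a h
    have := congrArg Complex.re h
    simp at this
    exact hz.ne' this
  have hf := differentiableOn_evalC hR
  have hg : DifferentiableOn ℂ (fun z => evalC R z - β / (z - ω * Complex.I)) {z | 0 < z.re} :=
    hf.sub ((differentiableOn_const _).div (differentiableOn_id.sub_const _)
      fun z hz => hne z hz ω)
  have hlim2 : Filter.Tendsto (fun ε : ℝ => (ε : ℂ) *
      (evalC R ((-ω : ℝ) * Complex.I + ε) - β / ((-ω : ℝ) * Complex.I + ε - ω * Complex.I)))
      (nhdsWithin 0 (Set.Ioi 0)) (nhds (β : ℂ)) := by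
    have h1 := (Complex.continuous_conj.tendsto _).comp hlim
    have hd : (-2 * ω * Complex.I : ℂ) ≠ 0 := by
      simp [hω.ne']
    have h2 : Filter.Tendsto (fun ε : ℝ => (ε : ℂ) * (β / (-2 * ω * Complex.I + ε)))
        (nhdsWithin 0 (Set.Ioi 0)) (nhds (0 * (β / (-2 * ω * Complex.I)))) := by
      have h0 := tendsto_add_ofReal 0
      simp only [zero_add] at h0
      exact h0.mul (tendsto_const_nhds.div (tendsto_add_ofReal _) hd)
    have h3 := h1.sub h2
    simp only [Complex.conj_ofReal, zero_mul, sub_zero] at h3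
    refine h3.congr fun ε => ?_
    simp only [Function.comp, map_mul, Complex.conj_ofReal, ← evalC_conj, map_add,
      Complex.conj_I]
    rw [mul_sub]
    push_cast
    congr 4 <;> ring
  have h := re_sub_simple_pole_nonneg hg
    (fun z hz => re_sub_simple_pole_nonneg hf hR.2 hβ hlim hz) hβ hlim2 hz
  have e : evalC R z - 2 * β * z / (z ^ 2 + (ω : ℂ) ^ 2)
      = evalC R z - β / (z - ω * Complex.I) - β / (z - (-ω : ℝ) * Complex.I) := by
    have h1 := hne z hz ω
    have h2 := hne z hz (-ω)
    have e2 : z ^ 2 + (ω : ℂ) ^ 2 = (z - ω * Complex.I) * (z - (-ω : ℝ) * Complex.I) := by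
      push_cast
      linear_combination ((ω : ℂ) ^ 2) * Complex.I_sq
    rw [e2]
    simp only [Complex.ofReal_neg, neg_mul, sub_neg_eq_add] at h2 ⊢
    field_simp
    ring
  rw [e]
  exact h

lemma sq_add_sq_dvd {P : ℝ[X]} {ω : ℝ} (hω : 0 < ω)
    (h : aeval ((ω : ℂ) * Complex.I) P = 0) : X ^ 2 + C (ω ^ 2) ∣ P := by
  have := P.quadratic_dvd_of_aeval_eq_zero_im_ne_zero h (by simpa using hω.ne')
  simpa using this

lemma natDegree_sq_add_sq_mul {P : ℝ[X]} (hP : P ≠ 0) (ω : ℝ) :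
    ((X ^ 2 + C (ω ^ 2)) * P).natDegree = P.natDegree + 2 := by
  have h0 : (X ^ 2 + C (ω ^ 2) : ℝ[X]) ≠ 0 := (monic_X_pow_add_C _ two_ne_zero).ne_zero
  rw [natDegree_mul h0 hP, natDegree_X_pow_add_C, add_comm]

lemma ofReal_mul_I_sub_ne_zero {ω : ℝ} (hω : 0 < ω) (ν : ℝ) :
    (ω : ℂ) * Complex.I - ν ≠ 0 := by
  intro h
  have := congrArg Complex.im h
  simp at this
  exact hω.ne' this

/-- The Richards transform of a positive-real function is positive-real. -/
lemma isPR_richards {H : RatFunc ℝ} (hH : IsPR H) {ν k : ℝ} (hν : 0 < ν) (hHν : evalR H ν = k)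
    (hB : X * H.num - C (ν * k) * H.denom ≠ 0) :
    IsPR (algebraMap ℝ[X] (RatFunc ℝ) (X * (C k * H.denom) - C ν * H.num) /
      algebraMap ℝ[X] (RatFunc ℝ) (X * H.num - C (ν * k) * H.denom)) := by
  refine isPR_algebraMap_div hB fun z hz hBz => ?_
  have hq : aeval z H.denom ≠ 0 := hH.1 z hz
  have hS := schwarzPick (differentiableOn_evalC hH) hH.2 hz (w := (ν : ℂ)) (by simpa using hν)
  rw [evalC_ofReal, hHν, Complex.conj_ofReal, Complex.conj_ofReal, evalC_eq_aeval] at hS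
  set a := aeval z (X * (C k * H.denom) - C ν * H.num) with ha
  set b := aeval z (X * H.num - C (ν * k) * H.denom) with hb
  simp only [map_sub, map_mul, aeval_X, aeval_C, Complex.coe_algebraMap] at ha hb
  set p := aeval z H.num
  set q := aeval z H.denom
  have e1 : a - b = -((p / q - k) * (z + ν) * q) := by
    rw [ha, hb]; field_simp; ring
  have e2 : a + b = (z - ν) * (p / q + k) * q := by
    rw [ha, hb]; field_simp; ring
  have hab : ‖a - b‖ ≤ ‖a + b‖ := by
    rw [e1, e2, norm_neg, norm_mul, norm_mul, norm_mul _ q, norm_mul]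
    exact mul_le_mul_of_nonneg_right hS (norm_nonneg _)
  have hab2 : ‖a - b‖ ^ 2 ≤ ‖a + b‖ ^ 2 := pow_le_pow_left₀ (norm_nonneg _) hab 2
  rw [div_re_eq]
  refine div_nonneg ?_ (by positivity)
  simp only [Complex.sq_norm, Complex.normSq_apply, Complex.sub_re, Complex.sub_im,
    Complex.add_re, Complex.add_im] at hab2
  simp only [Complex.mul_re, Complex.conj_re, Complex.conj_im]
  nlinarith [hab2]

/-- The algebraic inversion of the Richards transform followed by extraction of a pole pair. -/
lemma eq_mul_div_of_richards {F : Type*} [Field F] {h n d a b c e x k ν w t β : F}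
    (hh : h = n / d) (hd : d ≠ 0) (he : e ≠ 0) (hk : k ≠ 0) (hxν : x + ν ≠ 0)
    (h1 : (x + ν) * n = ν * a + x * b) (h2 : (x + ν) * (k * d) = x * a + ν * b)
    (hb : b = (x ^ 2 + w ^ 2) * c) (ha : a - t * β * (x * c) = (x ^ 2 + w ^ 2) * e) :
    h = k * (c / e * x ^ 3 + ν * x ^ 2 + c / e * (w ^ 2 + t * β * ν) * x + ν * w ^ 2) /
      (x ^ 3 + c / e * (t * β + ν) * x ^ 2 + w ^ 2 * x + c / e * (ν * w ^ 2)) := by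
  have hnum : c / e * x ^ 3 + ν * x ^ 2 + c / e * (w ^ 2 + t * β * ν) * x + ν * w ^ 2
      = (x + ν) * n / e := by
    field_simp
    linear_combination -h1 - x * hb - ν * ha
  have hden : x ^ 3 + c / e * (t * β + ν) * x ^ 2 + w ^ 2 * x + c / e * (ν * w ^ 2)
      = (x + ν) * (k * d) / e := by
    field_simp
    linear_combination -h2 - x * ha - ν * hb
  rw [hnum, hden, hh]
  field_simp

lemma natDegree_richards_le {H : RatFunc ℝ} {k ν ω r : ℝ} {A B D E : ℝ[X]}
    (hA : X * (C k * H.denom) - C ν * H.num = (X - C ν) * A)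
    (hB : X * H.num - C (ν * k) * H.denom = (X - C ν) * B)
    (hD : B = (X ^ 2 + C (ω ^ 2)) * D) (hE : A - C r * (X * D) = (X ^ 2 + C (ω ^ 2)) * E)
    (hA0 : A ≠ 0) (hD0 : D ≠ 0) (hE0 : E ≠ 0) :
    max D.natDegree E.natDegree + 2 ≤ McMillanDeg H := by
  have hnN : H.num.natDegree ≤ McMillanDeg H := le_max_left _ _
  have hdN : H.denom.natDegree ≤ McMillanDeg H := le_max_right _ _
  generalize McMillanDeg H = N at hnN hdN ⊢
  have hXA : (X * (C k * H.denom) - C ν * H.num).natDegree ≤ N + 1 := by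
    have h1 := natDegree_sub_le (X * (C k * H.denom)) (C ν * H.num)
    have h2 := natDegree_mul_le (p := X) (q := C k * H.denom)
    have h3 := natDegree_C_mul_le k H.denom
    have h4 := natDegree_C_mul_le ν H.num
    have h5 := natDegree_X_le (R := ℝ)
    omega
  have hXB : (X * H.num - C (ν * k) * H.denom).natDegree ≤ N + 1 := by
    have h1 := natDegree_sub_le (X * H.num) (C (ν * k) * H.denom)
    have h2 := natDegree_mul_le (p := X) (q := H.num)
    have h3 := natDegree_C_mul_le (ν * k) H.denom
    have h5 := natDegree_X_le (R := ℝ)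
    omega
  have hνX : (X - C ν : ℝ[X]) ≠ 0 := X_sub_C_ne_zero ν
  have hB0 : B ≠ 0 := hD ▸ mul_ne_zero (monic_X_pow_add_C _ two_ne_zero).ne_zero hD0
  rw [hA, natDegree_mul hνX hA0, natDegree_X_sub_C] at hXA
  rw [hB, natDegree_mul hνX hB0, natDegree_X_sub_C, hD, natDegree_sq_add_sq_mul hD0] at hXB
  have hXE : (A - C r * (X * D)).natDegree ≤ N := by
    have h1 := natDegree_sub_le A (C r * (X * D))
    have h2 := natDegree_C_mul_le r (X * D)
    have h3 := natDegree_mul_le (p := X) (q := D)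
    have h5 := natDegree_X_le (R := ℝ)
    omega
  rw [hE, natDegree_sq_add_sq_mul hE0] at hXE
  omega

/-- If `H` is a minimum function with minimum frequency `ω₀` and
`H(jω₀) = jω₀X` with `X < 0`, then there exist `ν, β > 0` and a PR function
`H̃_r` of McMillan degree at most that of `H` minus two, realizing the stated
identity of rational functions. -/
theorem stmt1 (H : RatFunc ℝ) (ω₀ X : ℝ) (hmin : IsMinFun H ω₀)
    (hval : evalC H ((ω₀ : ℂ) * Complex.I) = Complex.I * (ω₀ : ℂ) * (X : ℂ))
    (hX : X < 0) :
    ∃ (ν β : ℝ) (Hr : RatFunc ℝ), 0 < ν ∧ 0 < β ∧ IsPR Hr ∧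
      McMillanDeg Hr + 2 ≤ McMillanDeg H ∧
      H = RatFunc.C (evalR H ν) *
          (Hr * RatFunc.X ^ 3 + RatFunc.C ν * RatFunc.X ^ 2 +
            Hr * RatFunc.C (ω₀ ^ 2 + 2 * β * ν) * RatFunc.X +
            RatFunc.C (ν * ω₀ ^ 2)) /
          (RatFunc.X ^ 3 + Hr * RatFunc.C (2 * β + ν) * RatFunc.X ^ 2 +
            RatFunc.C (ω₀ ^ 2) * RatFunc.X + Hr * RatFunc.C (ν * ω₀ ^ 2)) := by

  obtain ⟨hPR, hH0, hN, hω, -⟩ := hmin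
  have hc : 0 < -ω₀ ^ 2 * X := by nlinarith [pow_pos hω 2]
  obtain ⟨ν, hν, hqν, hνk⟩ := exists_pos_mul_evalR_eq hPR hH0 hN hc
  set k := evalR H ν with hk
  have hk0 : 0 < k := pos_of_mul_pos_right (hνk ▸ hc) hν.le
  have hpk : H.num.eval ν = k * H.denom.eval ν := by
    rw [hk, evalR, div_mul_cancel₀ _ hqν]
  obtain ⟨A, hA⟩ : Polynomial.X - C ν ∣ Polynomial.X * (C k * H.denom) - C ν * H.num := by
    rw [dvd_iff_isRoot]
    simp [hpk]
  obtain ⟨B, hB⟩ : Polynomial.X - C ν ∣ Polynomial.X * H.num - C (ν * k) * H.denom := by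
    rw [dvd_iff_isRoot]
    simp [hpk]
    ring
  have hνX : (Polynomial.X - C ν : ℝ[X]) ≠ 0 := X_sub_C_ne_zero ν
  have hI1 : (Polynomial.X + C ν) * H.num = C ν * A + Polynomial.X * B := by
    apply mul_left_cancel₀ hνX
    rw [C_mul] at hB
    linear_combination C ν * hA + Polynomial.X * hB
  have hI2 : (Polynomial.X + C ν) * (C k * H.denom) = Polynomial.X * A + C ν * B := by
    apply mul_left_cancel₀ hνX
    rw [C_mul] at hB
    linear_combination Polynomial.X * hA + C ν * hB
  have hjq : aeval ((ω₀ : ℂ) * Complex.I) H.denom ≠ 0 := hN.2.2 ω₀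
  have hjp : aeval ((ω₀ : ℂ) * Complex.I) H.num
      = Complex.I * ω₀ * X * aeval ((ω₀ : ℂ) * Complex.I) H.denom := by
    rw [evalC_eq_aeval, div_eq_iff hjq] at hval
    exact hval
  have hjν := ofReal_mul_I_sub_ne_zero hω ν
  have hνkc : (ν : ℂ) * k = -(ω₀ : ℂ) ^ 2 * X := by exact_mod_cast hνk
  have hjB : aeval ((ω₀ : ℂ) * Complex.I) B = 0 := by
    have h := congrArg (aeval ((ω₀ : ℂ) * Complex.I)) hB
    simp only [map_sub, map_mul, aeval_X, aeval_C, Complex.coe_algebraMap, hjp, hνkc] at h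
    refine (mul_eq_zero.1 (h.symm.trans ?_)).resolve_left hjν
    linear_combination (ω₀ : ℂ) ^ 2 * X * aeval ((ω₀ : ℂ) * Complex.I) H.denom * Complex.I_sq
  have hjA : aeval ((ω₀ : ℂ) * Complex.I) A ≠ 0 := by
    intro h0
    have h := congrArg (aeval ((ω₀ : ℂ) * Complex.I)) hA
    simp only [map_sub, map_mul, aeval_X, aeval_C, Complex.coe_algebraMap, hjp, h0,
      mul_zero] at h
    have h1 : (ω₀ : ℂ) * Complex.I * ((k - ν * X : ℝ) : ℂ)
        * aeval ((ω₀ : ℂ) * Complex.I) H.denom = 0 := by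
      rw [← h]; push_cast; ring
    have h2 : k - ν * X ≠ 0 := by nlinarith
    exact mul_ne_zero (mul_ne_zero (mul_ne_zero (by exact_mod_cast hω.ne') Complex.I_ne_zero)
      (by exact_mod_cast h2)) hjq h1
  obtain ⟨D, hD⟩ := sq_add_sq_dvd hω hjB
  have hp0 : H.num.eval 0 ≠ 0 := by
    intro h0
    refine hN.2.1 0 ?_
    rw [← aeval_def]
    simpa [h0] using aeval_algebraMap_apply ℂ (0 : ℝ) H.num
  have hq0 : H.denom.eval 0 ≠ 0 := by
    intro h0
    refine hN.2.2 0 ?_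
    rw [← aeval_def]
    simpa [h0] using aeval_algebraMap_apply ℂ (0 : ℝ) H.denom
  have hA0 : A.eval 0 ≠ 0 := by
    intro h0
    have h := congrArg (eval 0) hA
    simp [h0, hν.ne', hp0] at h
  have hB0 : B ≠ 0 := by
    rintro rfl
    have h := congrArg (eval 0) hB
    simp [hν.ne', hk0.ne', hq0] at h
  have hD0 : D ≠ 0 := by
    rintro rfl
    exact hB0 (by rw [hD, mul_zero])
  have hB' : Polynomial.X * H.num - C (ν * k) * H.denom ≠ 0 := hB ▸ mul_ne_zero hνX hB0
  have hR := isPR_richards hPR hν hk.symm hB'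
  set R := algebraMap ℝ[X] (RatFunc ℝ) (Polynomial.X * (C k * H.denom) - C ν * H.num) /
      algebraMap ℝ[X] (RatFunc ℝ) (Polynomial.X * H.num - C (ν * k) * H.denom) with hRdef
  have hRAB : R = algebraMap ℝ[X] (RatFunc ℝ) A / algebraMap ℝ[X] (RatFunc ℝ) B := by
    rw [hRdef, hA, hB, map_mul, map_mul, mul_div_mul_left _ _ (RatFunc.algebraMap_ne_zero hνX)]
  have hRA : ∀ z : ℂ, 0 < z.re → aeval z D ≠ 0 →
      evalC R z = aeval z A / ((z ^ 2 + (ω₀ : ℂ) ^ 2) * aeval z D) := by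
    intro z hz hDz
    have hBz : aeval z B = (z ^ 2 + (ω₀ : ℂ) ^ 2) * aeval z D := by
      rw [hD]; simp
    rw [hRAB, evalC_algebraMap_div, hBz]
    rw [hBz]
    exact mul_ne_zero (sq_add_sq_ne_zero hz ω₀) hDz
  obtain ⟨β, hβ, hres, hlim⟩ := exists_residue_pos hR hω hD0 hjA hRA
  obtain ⟨E, hE⟩ : Polynomial.X ^ 2 + C (ω₀ ^ 2) ∣ A - C (2 * β) * (Polynomial.X * D) := by
    refine sq_add_sq_dvd hω ?_
    simp [hres]
    ring
  have hE0 : E ≠ 0 := by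
    rintro rfl
    have h := congrArg (eval 0) hE
    simp [hA0] at h
  have hdeg := natDegree_richards_le hA hB hD hE
    (fun h => hA0 (by rw [h, eval_zero])) hD0 hE0
  have hHr : IsPR (algebraMap ℝ[X] (RatFunc ℝ) D / algebraMap ℝ[X] (RatFunc ℝ) E) := by
    refine isPR_algebraMap_div hE0 fun z hz hEz => ?_
    by_cases hDz : aeval z D = 0
    · simp [hDz]
    · have h1 := re_sub_pole_pair_nonneg hR hω hβ hlim hz
      have hz2 := sq_add_sq_ne_zero hz ω₀
      have hEz' := congrArg (aeval z) hE
      simp only [map_sub, map_mul, map_add, map_pow, aeval_X, aeval_C,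
        Complex.coe_algebraMap, Complex.ofReal_ofNat] at hEz'
      have h2 : evalC R z - 2 * β * z / (z ^ 2 + (ω₀ : ℂ) ^ 2) = aeval z E / aeval z D := by
        rw [hRA z hz hDz]
        field_simp
        linear_combination hEz'
      rw [h2] at h1
      rw [← inv_div, Complex.inv_re]
      exact div_nonneg h1 (Complex.normSq_nonneg _)
  refine ⟨ν, β, algebraMap ℝ[X] (RatFunc ℝ) D / algebraMap ℝ[X] (RatFunc ℝ) E, hν, hβ, hHr,
    (Nat.add_le_add_right (mcMillanDeg_algebraMap_div_le hD0 hE0) 2).trans hdeg, ?_⟩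
  have hJ1 := congrArg (algebraMap ℝ[X] (RatFunc ℝ)) hI1
  have hJ2 := congrArg (algebraMap ℝ[X] (RatFunc ℝ)) hI2
  have hJD := congrArg (algebraMap ℝ[X] (RatFunc ℝ)) hD
  have hJE := congrArg (algebraMap ℝ[X] (RatFunc ℝ)) hE
  have hd := RatFunc.algebraMap_ne_zero (K := ℝ) H.denom_ne_zero
  have he := RatFunc.algebraMap_ne_zero (K := ℝ) hE0
  have hkk : (RatFunc.C k : RatFunc ℝ) ≠ 0 := by simpa using hk0.ne'
  have hxν : (RatFunc.X + RatFunc.C ν : RatFunc ℝ) ≠ 0 := by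
    have := RatFunc.algebraMap_ne_zero (K := ℝ) (X_add_C_ne_zero ν)
    simpa using this
  simp only [map_add, map_sub, map_mul, map_pow, RatFunc.algebraMap_X, RatFunc.algebraMap_C]
    at hJ1 hJ2 hJD hJE
  simp only [map_add, map_mul, map_pow]
  exact eq_mul_div_of_richards (RatFunc.num_div_denom H).symm hd he hkk hxν hJ1 hJ2 hJD hJE
end

section
/- Let K, ω₀ > 0 and let W, F be real numbers satisfying either (0 < W < 1 and F > 0) or (W > 1 and F < 0). Then H := H_{K,ω₀,W,F} is a biquadratic minimum function with minimum frequency ω₀; that is, H is PR, not identically zero, its (coprime) numerator and denominator are quadratics with no purely imaginary roots, and Re(H(jω₀)) = 0. -/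
open Polynomial Matrix

/-- A fraction of coprime polynomials with monic denominator is in `num`/`denom` form. -/
theorem RatFunc.num_denom_eq_of_isCoprime {k : Type*} [Field k] {x : RatFunc k} {p q : k[X]}
    (hq : q.Monic) (hpq : IsCoprime p q)
    (hx : x = algebraMap k[X] (RatFunc k) p / algebraMap k[X] (RatFunc k) q) :
    x.num = p ∧ x.denom = q := by
  have h := (RatFunc.num_mul_eq_mul_denom_iff hq.ne_zero).mpr hx
  have hd : x.denom = q := by
    refine eq_of_monic_of_associated x.monic_denom hq (associated_of_dvd_dvd ?_ ?_)
    · exact x.isCoprime_num_denom.symm.dvd_of_dvd_mul_left (h ▸ dvd_mul_left _ _)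
    · exact hpq.symm.dvd_of_dvd_mul_left (h ▸ dvd_mul_left _ _)
  rw [hd] at h
  exact ⟨mul_right_cancel₀ hq.ne_zero h, hd⟩

/-- Two monic quadratics with nonzero resultant are coprime. -/
theorem isCoprime_monic_quadratic {k : Type*} [Field k] {a b c d : k}
    (h : (b - d) ^ 2 + (a - c) * (a * d - b * c) ≠ 0) :
    IsCoprime (X ^ 2 + C a * X + C b : k[X]) (X ^ 2 + C c * X + C d) := by
  set r := (b - d) ^ 2 + (a - c) * (a * d - b * c) with hr
  refine ⟨C (-r⁻¹) * (C (a - c) * X + C (c * (a - c) - (b - d))),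
    C r⁻¹ * (C (a - c) * X + C (a * (a - c) - (b - d))), ?_⟩
  have h1 : (C r⁻¹ * C r : k[X]) = 1 := by rw [← C_mul, inv_mul_cancel₀ h, C_1]
  rw [← h1, hr]
  simp only [C_neg, C_sub, C_mul, C_add, C_pow]
  ring

theorem monic_quadratic {k : Type*} [Field k] (a b : k) :
    (X ^ 2 + C a * X + C b : k[X]).Monic := by
  simpa [Monic] using leadingCoeff_quadratic (b := a) (c := b) (one_ne_zero (α := k))

theorem natDegree_monic_quadratic {k : Type*} [Field k] (a b : k) :
    (X ^ 2 + C a * X + C b : k[X]).natDegree = 2 := by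
  simpa using natDegree_quadratic (b := a) (c := b) (one_ne_zero (α := k))

/-- A real monic quadratic with positive coefficients has no root in the closed right
half-plane. -/
theorem quadratic_ne_zero_of_re_nonneg {a b : ℝ} (ha : 0 < a) (hb : 0 < b) {z : ℂ}
    (hz : 0 ≤ z.re) : z ^ 2 + a * z + b ≠ 0 := by
  intro h
  have hre := congrArg Complex.re h
  have him := congrArg Complex.im h
  simp [pow_two] at hre him
  have hy : z.im = 0 := by
    have : z.im * (2 * z.re + a) = 0 := by linarith
    exact (mul_eq_zero.mp this).resolve_right (by positivity)
  rw [hy] at hre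
  nlinarith [mul_nonneg ha.le hz, mul_nonneg hz hz]

/-- If `b * d = w ^ 2` and `b + d - a * c = 2 * w`, the quotient of two real monic quadratics has
real part given by an expression that is nonnegative for nonnegative coefficients and `z.re`. -/
theorem re_quadratic_div_quadratic {a b c d w : ℝ} (hbd : b * d = w ^ 2)
    (hac : b + d - a * c = 2 * w) (z : ℂ) :
    ((z ^ 2 + a * z + b) / (z ^ 2 + c * z + d)).re =
      ((Complex.normSq z - w) ^ 2 + (a + c) * z.re * Complex.normSq z +
        2 * (b + d) * z.re ^ 2 + (a * d + b * c) * z.re) /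
          Complex.normSq (z ^ 2 + c * z + d) := by
  rw [Complex.div_re, ← add_div]
  congr 1
  simp [pow_two, Complex.normSq_apply]
  linear_combination hbd - (z.re * z.re + z.im * z.im) * hac

theorem Hparam_num_denom {K ω₀ W F : ℝ} (hK : K ≠ 0) (hω : ω₀ ≠ 0) (hW : 0 < W)
    (hW1 : W ≠ 1) (hF : F ≠ 0) :
    (Hparam K ω₀ W F).num =
        C K * (X ^ 2 + C (ω₀ * (1 - W) * F / W) * X + C (ω₀ ^ 2 * W)) ∧
      (Hparam K ω₀ W F).denom =
        X ^ 2 + C (ω₀ * (1 - W) / F) * X + C (ω₀ ^ 2 / W) := by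
  refine RatFunc.num_denom_eq_of_isCoprime (monic_quadratic _ _) ?_ ?_
  · refine (isCoprime_mul_unit_left_left (isUnit_C.mpr hK.isUnit) _ _).mpr
      (isCoprime_monic_quadratic ?_)
    have hr : (ω₀ ^ 2 * W - ω₀ ^ 2 / W) ^ 2 + (ω₀ * (1 - W) * F / W - ω₀ * (1 - W) / F) *
        (ω₀ * (1 - W) * F / W * (ω₀ ^ 2 / W) - ω₀ ^ 2 * W * (ω₀ * (1 - W) / F)) =
        ω₀ ^ 4 * (1 - W) ^ 2 * (F ^ 2 + W ^ 2) ^ 2 / (W ^ 3 * F ^ 2) := by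
      field_simp
      ring
    rw [hr]
    have : 1 - W ≠ 0 := sub_ne_zero.mpr hW1.symm
    positivity
  · simp [Hparam]

/-- for admissible parameters, `Hparam K ω₀ W F` is a biquadratic
minimum function with minimum frequency `ω₀`: it is PR, nonzero, its coprime
numerator and denominator are quadratics with no purely imaginary roots, and
`Re (H (jω₀)) = 0`. -/
theorem stmt6 (K ω₀ W F : ℝ) (hK : 0 < K) (hω : 0 < ω₀)
    (hWF : (0 < W ∧ W < 1 ∧ 0 < F) ∨ (1 < W ∧ F < 0)) :
    IsMinFun (Hparam K ω₀ W F) ω₀ ∧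
    (Hparam K ω₀ W F).num.natDegree = 2 ∧
    (Hparam K ω₀ W F).denom.natDegree = 2 := by
  have hW : 0 < W := by rcases hWF with h | h <;> linarith
  have hW1 : W ≠ 1 := by rcases hWF with h | h <;> [exact h.2.1.ne; exact h.1.ne']
  have hF : F ≠ 0 := by rcases hWF with h | h <;> [exact h.2.2.ne'; exact h.2.ne]
  have hWF' : 0 < (1 - W) * F := by
    rcases hWF with h | h
    · exact mul_pos (by linarith) h.2.2
    · exact mul_pos_of_neg_of_neg (by linarith) h.2
  obtain ⟨hnum, hden⟩ := Hparam_num_denom hK.ne' hω.ne' hW hW1 hF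
  have ha : 0 < ω₀ * (1 - W) * F / W := by
    rw [mul_assoc]
    positivity
  have hc : 0 < ω₀ * (1 - W) / F := by
    have : ω₀ * (1 - W) / F = ω₀ * ((1 - W) * F) / F ^ 2 := by field_simp
    rw [this]
    positivity
  have hb : 0 < ω₀ ^ 2 * W := by positivity
  have hd : 0 < ω₀ ^ 2 / W := by positivity
  have hbd : ω₀ ^ 2 * W * (ω₀ ^ 2 / W) = (ω₀ ^ 2) ^ 2 := by field_simp
  have hac : ω₀ ^ 2 * W + ω₀ ^ 2 / W - ω₀ * (1 - W) * F / W * (ω₀ * (1 - W) / F) =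
      2 * ω₀ ^ 2 := by
    field_simp
    ring
  generalize ω₀ * (1 - W) * F / W = a at *
  generalize ω₀ * (1 - W) / F = c at *
  generalize ω₀ ^ 2 * W = b at *
  generalize ω₀ ^ 2 / W = d at *
  have hnumC (z : ℂ) : (Hparam K ω₀ W F).num.eval₂ (algebraMap ℝ ℂ) z =
      K * (z ^ 2 + a * z + b) := by
    simp [hnum, eval₂_add, eval₂_mul]
  have hdenC (z : ℂ) : (Hparam K ω₀ W F).denom.eval₂ (algebraMap ℝ ℂ) z =
      z ^ 2 + c * z + d := by
    simp [hden, eval₂_add, eval₂_mul]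
  have hre (z : ℂ) := re_quadratic_div_quadratic hbd hac z
  have hevalC (z : ℂ) : (evalC (Hparam K ω₀ W F) z).re =
      K * ((z ^ 2 + a * z + b) / (z ^ 2 + c * z + d)).re := by
    rw [evalC, hnumC, hdenC, mul_div_assoc, Complex.re_ofReal_mul]
  have hnumdeg : (Hparam K ω₀ W F).num.natDegree = 2 := by
    rw [hnum, natDegree_C_mul hK.ne', natDegree_monic_quadratic]
  have hdendeg : (Hparam K ω₀ W F).denom.natDegree = 2 := by
    rw [hden, natDegree_monic_quadratic]
  refine ⟨⟨⟨fun z hz => ?_, fun z hz => ?_⟩, fun h => ?_,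
    ⟨hnumdeg.trans hdendeg.symm, fun ω => ?_, fun ω => ?_⟩, hω, ?_⟩, hnumdeg, hdendeg⟩
  · rw [hdenC]
    exact quadratic_ne_zero_of_re_nonneg hc hd hz.le
  · rw [hevalC, hre]
    have := Complex.normSq_nonneg z
    have := Complex.normSq_nonneg (z ^ 2 + c * z + d)
    positivity
  · simp [h] at hnumdeg
  · rw [hnumC]
    exact mul_ne_zero (Complex.ofReal_ne_zero.mpr hK.ne')
      (quadratic_ne_zero_of_re_nonneg ha hb (by simp))
  · rw [hdenC]
    exact quadratic_ne_zero_of_re_nonneg hc hd (by simp)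
  · rw [hevalC, hre]
    simp [← pow_two]
end
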